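/- Let K be a positive natural number, C a K×K complex positive semidefinite Hermitian matrix, h ∈ ℂ^K, ε ≥ 0 and t ∈ ℝ. If there exists a real μ ≥ 0 such that the (K+1)×(K+1) Hermitian block matrix T(μ) = [[ μ·I_K + C , C h ], [ (C h)* , h* C h − t − μ·ε² ]] is positive semidefinite, then for every η ∈ ℂ^K with ‖η‖ ≤ ε one has (h+η)* C (h+η) ≥ t. -/

import Mathlib

open Matrix Finset
open scoped ComplexOrder

/-- The quadratic form of a matrix bordered by a column `v`, its adjoint and a scalar `c`,
evaluated at the vector `(x, 1)`. -/
theorem star_sumElim_one_dotProduct_fromBlocks_mulVec {n R : Type*} [Fintype n] [CommRing R]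
    [StarRing R] (A : Matrix n n R) (v x : n → R) (c : R) :
    star (Sum.elim x (1 : Fin 1 → R)) ⬝ᵥ
        (Matrix.fromBlocks A (Matrix.of fun k (_ : Fin 1) => v k)
          (Matrix.of fun (_ : Fin 1) k => star (v k))
          (Matrix.of fun (_ : Fin 1) (_ : Fin 1) => c)) *ᵥ Sum.elim x 1 =
      star x ⬝ᵥ A *ᵥ x + star x ⬝ᵥ v + star v ⬝ᵥ x + c := by
  simp only [Matrix.fromBlocks_mulVec, Function.star_sumElim, sumElim_dotProduct_sumElim,
    Sum.elim_comp_inl, Sum.elim_comp_inr, dotProduct_add]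
  simp [dotProduct, mulVec, add_assoc]

/-- The quadratic form of a Hermitian matrix at a sum of two vectors. -/
theorem Matrix.IsHermitian.star_add_dotProduct_mulVec_add {n R : Type*} [Fintype n] [CommRing R]
    [StarRing R] {C : Matrix n n R} (hC : C.IsHermitian) (x y : n → R) :
    star (x + y) ⬝ᵥ C *ᵥ (x + y) =
      star y ⬝ᵥ C *ᵥ y + star y ⬝ᵥ C *ᵥ x + star (C *ᵥ x) ⬝ᵥ y + star x ⬝ᵥ C *ᵥ x := by
  rw [star_mulVec, hC.eq, ← dotProduct_mulVec]
  simp only [star_add, mulVec_add, dotProduct_add, add_dotProduct]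
  ring

theorem star_dotProduct_self_eq_sum_norm_sq {n : Type*} [Fintype n] (x : n → ℂ) :
    star x ⬝ᵥ x = ((∑ k, ‖x k‖ ^ 2 : ℝ) : ℂ) := by
  simp [Complex.conj_mul', dotProduct]

/-- Sufficiency direction of Lemma 1: for a PSD Hermitian `C`, estimated channel
`h`, error radius `ε ≥ 0` and threshold `t`, if there exists `μ ≥ 0` such that
the Hermitian block matrix `[[μI + C, Ch], [(Ch)*, h*Ch − t − με²]]` is PSD, then
every `η` with `‖η‖ ≤ ε` satisfies `(h+η)* C (h+η) ≥ t`. -/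
theorem LMI_implies_robust_energy_constraint (K : ℕ) (hK : 0 < K)
    (C : Matrix (Fin K) (Fin K) ℂ) (hC : C.PosSemidef) (h : Fin K → ℂ)
    (ε : ℝ) (hε : 0 ≤ ε) (t : ℝ)
    (hLMI : ∃ μ : ℝ, 0 ≤ μ ∧
        (Matrix.fromBlocks
            ((μ : ℂ) • (1 : Matrix (Fin K) (Fin K) ℂ) + C)
            (Matrix.of fun k (_ : Fin 1) => (C *ᵥ h) k)
            (Matrix.of fun (_ : Fin 1) k => star ((C *ᵥ h) k))
            (Matrix.of fun (_ : Fin 1) (_ : Fin 1) =>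
              star h ⬝ᵥ C *ᵥ h - (t : ℂ) - ((μ * ε ^ 2 : ℝ) : ℂ))).PosSemidef) :
    ∀ η : Fin K → ℂ, Real.sqrt (∑ k, ‖η k‖ ^ 2) ≤ ε →
      (t : ℂ) ≤ star (h + η) ⬝ᵥ C *ᵥ (h + η) := by
  intro η hη
  obtain ⟨μ, hμ, hT⟩ := hLMI
  have hform := hT.dotProduct_mulVec_nonneg (Sum.elim η 1)
  rw [star_sumElim_one_dotProduct_fromBlocks_mulVec, add_mulVec, smul_mulVec, one_mulVec,
    dotProduct_add, dotProduct_smul, star_dotProduct_self_eq_sum_norm_sq, smul_eq_mul] at hform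
  have hball : ((μ * ∑ k, ‖η k‖ ^ 2 : ℝ) : ℂ) ≤ ((μ * ε ^ 2 : ℝ) : ℂ) :=
    Complex.real_le_real.mpr (mul_le_mul_of_nonneg_left ((Real.sqrt_le_left hε).mp hη) hμ)
  rw [hC.isHermitian.star_add_dotProduct_mulVec_add, ← sub_nonneg]
  refine (add_nonneg hform (sub_nonneg.mpr hball)).trans_eq ?_
  push_cast
  ring
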